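/- Let ε, ε̃ ∈ {0, 1} with ε ≠ ε̃, let f₆ : ℝ → ℝ be a C² function whose derivative f₆′ is nowhere zero, and let φ : ℝ⁶ → ℝ be a C² function satisfying, at every point x = (x¹,…,x⁶) ∈ ℝ⁶: (i) ∂₁φ = 0, ∂₂φ = 0 and ∂₄φ = 0; (ii) 3ε·∂₆φ(x) = f₆′(x⁶)·∂₃φ(x); (iii) 2ε̃·∂₆φ(x) = f₆′(x⁶)·∂₅φ(x); (iv) 3ε·∂₅φ(x) = 2ε̃·∂₃φ(x); (v) f₆′(x⁶)·∂₆∂₆φ(x) = f₆″(x⁶)·∂₆φ(x); (vi) ∂₃∂₅φ = 0, ∂₃∂₆φ = 0 and ∂₅∂₆φ = 0. Then there exist constants a₁, c ∈ ℝ such that φ(x) = (a₁/2)(3ε·x³ + 2ε̃·x⁵ + f₆(x⁶)) + c for all x ∈ ℝ⁶. -/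

import Mathlib

/-- Partial derivative of `φ : ℝ⁶ → ℝ` in the `i`-th coordinate direction
(`i : Fin 6` is the 0-based index, so `∂ᵢφ` of the paper is `pd (i-1) φ`). -/
noncomputable def pd (i : Fin 6) (φ : (Fin 6 → ℝ) → ℝ) : (Fin 6 → ℝ) → ℝ :=
  fun x => fderiv ℝ φ x (Pi.single i 1)

theorem hasFDerivAt_comp_apply {n : ℕ} {g : ℝ → ℝ} (hg : Differentiable ℝ g) (j : Fin n)
    (x : Fin n → ℝ) :
    HasFDerivAt (fun y : Fin n → ℝ => g (y j))
      (deriv g (x j) • (ContinuousLinearMap.proj j : (Fin n → ℝ) →L[ℝ] ℝ)) x :=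
  (hg (x j)).hasDerivAt.comp_hasFDerivAt x (hasFDerivAt_apply j x)

theorem eq_of_pd_eq_zero {ψ : (Fin 6 → ℝ) → ℝ} (hψ : Differentiable ℝ ψ)
    (h : ∀ i x, pd i ψ x = 0) (x y : Fin 6 → ℝ) : ψ x = ψ y := by
  refine is_const_of_fderiv_eq_zero (𝕜 := ℝ) hψ (fun z => ?_) x y
  apply ContinuousLinearMap.coe_injective
  refine LinearMap.pi_ext' fun i => LinearMap.ext_ring ?_
  simpa [pd] using h i z

theorem differentiable_pd {φ : (Fin 6 → ℝ) → ℝ} (hφ : ContDiff ℝ 2 φ) (i : Fin 6) :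
    Differentiable ℝ (pd i φ) :=
  ((hφ.fderiv_right (m := 1) (by norm_num)).clm_apply contDiff_const).differentiable (by norm_num)

theorem pd_comm {φ : (Fin 6 → ℝ) → ℝ} (hφ : ContDiff ℝ 2 φ) (i j : Fin 6) (x : Fin 6 → ℝ) :
    pd i (pd j φ) x = pd j (pd i φ) x := by
  have hd : DifferentiableAt ℝ (fderiv ℝ φ) x :=
    (hφ.fderiv_right (m := 1) (by norm_num)).differentiable (by norm_num) x
  have key : ∀ k l, pd k (pd l φ) x
      = fderiv ℝ (fderiv ℝ φ) x (Pi.single k 1) (Pi.single l 1) := by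
    intro k l
    have := (hd.hasFDerivAt.clm_apply (hasFDerivAt_const (Pi.single l (1 : ℝ)) x)).fderiv
    change fderiv ℝ (fun y => fderiv ℝ φ y (Pi.single l 1)) x (Pi.single k 1) = _
    rw [this]
    simp
  rw [key, key]
  exact (hφ.contDiffAt.isSymmSndFDerivAt (by simp)).eq _ _

theorem pd_eq_zero_of_pd_eq_zero {φ : (Fin 6 → ℝ) → ℝ} (hφ : ContDiff ℝ 2 φ) {i : Fin 6}
    (h : ∀ x, pd i φ x = 0) (j : Fin 6) (x : Fin 6 → ℝ) : pd i (pd j φ) x = 0 := by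
  rw [pd_comm hφ, show pd i φ = fun _ => 0 from funext h]
  simp [pd]

/-- Integration of the Eisenhart equations for the defining function of a
projective motion on the rigid 6-dimensional h-space of type [321] (generic case
f₆′ nowhere zero). Coordinates: x¹,…,x⁶ are `x 0, …, x 5`. -/
theorem stmt_3 (ε ε' : ℝ) (hε : ε = 0 ∨ ε = 1) (hε' : ε' = 0 ∨ ε' = 1) (hne : ε ≠ ε')
    (f₆ : ℝ → ℝ) (hf₆ : ContDiff ℝ 2 f₆) (hf₆' : ∀ t : ℝ, deriv f₆ t ≠ 0)
    (φ : (Fin 6 → ℝ) → ℝ) (hφ : ContDiff ℝ 2 φ)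
    -- (i) ∂₁φ = 0, ∂₂φ = 0, ∂₄φ = 0
    (h1 : ∀ x, pd 0 φ x = 0) (h2 : ∀ x, pd 1 φ x = 0) (h4 : ∀ x, pd 3 φ x = 0)
    -- (ii) 3ε·∂₆φ = f₆′·∂₃φ
    (h36 : ∀ x, 3 * ε * pd 5 φ x = deriv f₆ (x 5) * pd 2 φ x)
    -- (iii) 2ε̃·∂₆φ = f₆′·∂₅φ
    (h56 : ∀ x, 2 * ε' * pd 5 φ x = deriv f₆ (x 5) * pd 4 φ x)
    -- (iv) 3ε·∂₅φ = 2ε̃·∂₃φ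
    (h35 : ∀ x, 3 * ε * pd 4 φ x = 2 * ε' * pd 2 φ x)
    -- (v) f₆′·∂₆∂₆φ = f₆″·∂₆φ
    (h66 : ∀ x, deriv f₆ (x 5) * pd 5 (pd 5 φ) x = deriv (deriv f₆) (x 5) * pd 5 φ x)
    -- (vi) ∂₃∂₅φ = 0, ∂₃∂₆φ = 0, ∂₅∂₆φ = 0
    (h35' : ∀ x, pd 2 (pd 4 φ) x = 0)
    (h36' : ∀ x, pd 2 (pd 5 φ) x = 0)
    (h56' : ∀ x, pd 4 (pd 5 φ) x = 0) :
    ∃ a₁ c : ℝ, ∀ x : Fin 6 → ℝ,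
      φ x = (a₁ / 2) * (3 * ε * x 2 + 2 * ε' * x 4 + f₆ (x 5)) + c := by
  have hf : Differentiable ℝ f₆ := hf₆.differentiable (by norm_num)
  have hdf : Differentiable ℝ (deriv f₆) :=
    (hf₆.iterate_deriv' 1 1).differentiable (by norm_num)
  have hp : Differentiable ℝ (pd 5 φ) := differentiable_pd hφ 5
  -- The quotient `∂₆φ / f₆′` is constant.
  set G : (Fin 6 → ℝ) → ℝ := fun x => pd 5 φ x * (deriv f₆ (x 5))⁻¹ with hG
  have hGd : ∀ x, HasFDerivAt G _ x := fun x =>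
    (hp x).hasFDerivAt.fun_mul
      ((hasDerivAt_inv (hf₆' (x 5))).comp_hasFDerivAt x (hasFDerivAt_comp_apply hdf 5 x))
  have hGpd : ∀ i x, pd i G x = 0 := by
    intro i x
    have e : pd i G x = (deriv f₆ (x 5) ^ 2)⁻¹ *
        (deriv f₆ (x 5) * pd i (pd 5 φ) x -
          pd 5 φ x * (deriv (deriv f₆) (x 5) * (Pi.single i (1 : ℝ) : Fin 6 → ℝ) 5)) := by
      have := hf₆' (x 5)
      simp only [pd, (hGd x).fderiv]
      simp
      field_simp
      ring
    rw [e]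
    fin_cases i
    · simp [pd_eq_zero_of_pd_eq_zero hφ h1]
    · simp [pd_eq_zero_of_pd_eq_zero hφ h2]
    · simp [h36']
    · simp [pd_eq_zero_of_pd_eq_zero hφ h4]
    · simp [h56']
    · simp [h66, mul_comm]
  have hGc := eq_of_pd_eq_zero (fun x => (hGd x).differentiableAt) hGpd
  have h5 : ∀ x, pd 5 φ x = deriv f₆ (x 5) * G 0 := fun x => by
    rw [hGc 0 x, hG]
    field_simp [hf₆' (x 5)]
  have h3 : ∀ x, pd 2 φ x = 3 * ε * G 0 := fun x =>
    mul_left_cancel₀ (hf₆' (x 5)) (by rw [← h36, h5]; ring)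
  have h5' : ∀ x, pd 4 φ x = 2 * ε' * G 0 := fun x =>
    mul_left_cancel₀ (hf₆' (x 5)) (by rw [← h56, h5]; ring)
  have hψ : ∀ x, HasFDerivAt
      (fun y : Fin 6 → ℝ => φ y - G 0 * (3 * ε * y 2 + 2 * ε' * y 4 + f₆ (y 5))) _ x := fun x =>
    (hφ.differentiable (by norm_num) x).hasFDerivAt.fun_sub
      (((((hasFDerivAt_apply 2 x).const_mul (3 * ε)).fun_add
        ((hasFDerivAt_apply 4 x).const_mul (2 * ε'))).fun_add
        (hasFDerivAt_comp_apply hf 5 x)).const_mul (G 0))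
  have hψc := eq_of_pd_eq_zero (fun x => (hψ x).differentiableAt) (by
    intro i x
    have e : pd i (fun y => φ y - G 0 * (3 * ε * y 2 + 2 * ε' * y 4 + f₆ (y 5))) x =
        pd i φ x - G 0 * (3 * ε * (Pi.single i (1 : ℝ) : Fin 6 → ℝ) 2
          + 2 * ε' * (Pi.single i (1 : ℝ) : Fin 6 → ℝ) 4
          + deriv f₆ (x 5) * (Pi.single i (1 : ℝ) : Fin 6 → ℝ) 5) := by
      simp only [pd, (hψ x).fderiv]
      simp [mul_add]
    rw [e]
    fin_cases i
    · simp [h1]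
    · simp [h2]
    · simp [h3, mul_comm]
    · simp [h4]
    · simp [h5', mul_comm]
    · simp [h5, mul_comm])
  refine ⟨2 * G 0, φ 0 - G 0 * (f₆ 0), fun x => ?_⟩
  have := hψc x 0
  simp only [Pi.zero_apply] at this
  linarith
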